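/- Let f₁, f₂, … be multipliers of the Dirichlet space 𝒟 with column operator norm ‖M_F^C‖ ≤ 1, and let Q : 𝔻 → B(ℓ²) be an operator-valued analytic function each of whose matrix entries is either identically 0 or ±f_j for some index j, and whose entrywise derivative Q′ satisfies ‖Q′(z)x‖²_{ℓ²} ≤ (∑_{j=1}^∞ |f_j′(z)|²)‖x‖²_{ℓ²} for all z ∈ 𝔻 and x ∈ ℓ². Then for every ℓ²-valued harmonic function w = x + ȳ on a neighborhood of the closed unit disk, where x and y are analytic ℓ²-valued functions with components in 𝒟, one has ∫_𝔻 ‖Q′(z) w(z)‖²_{ℓ²} dA(z) ≤ 8 ‖w‖²_{ℋ𝒟}, where ‖w‖²_{ℋ𝒟} = ∑_k ‖x_k‖²_𝒟 + ∑_k ‖y_k‖²_𝒟. -/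

import Mathlib

open Metric MeasureTheory Complex

/-- Taylor coefficient at 0. -/
noncomputable def dirCoeff (f : ℂ → ℂ) (n : ℕ) : ℂ :=
  iteratedDeriv n f 0 / (n.factorial : ℂ)

/-- Membership in the Dirichlet space. -/
def MemDirichlet (f : ℂ → ℂ) : Prop :=
  DifferentiableOn ℂ f (ball (0:ℂ) 1) ∧
  Summable (fun n : ℕ => ((n : ℝ) + 1) * ‖dirCoeff f n‖ ^ 2)

/-- Squared Dirichlet norm. -/
noncomputable def dirNormSq (f : ℂ → ℂ) : ℝ :=
  ∑' n : ℕ, ((n : ℝ) + 1) * ‖dirCoeff f n‖ ^ 2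

/-- Multiplier of the Dirichlet space. -/
def IsMultiplier (φ : ℂ → ℂ) : Prop :=
  DifferentiableOn ℂ φ (ball (0:ℂ) 1) ∧
  ∀ f, MemDirichlet f → MemDirichlet (fun z => φ z * f z)

/-- Operator norm of the multiplication operator. -/
noncomputable def multNorm (φ : ℂ → ℂ) : ℝ :=
  sInf {C : ℝ | 0 ≤ C ∧ ∀ f, MemDirichlet f →
    dirNormSq (fun z => φ z * f z) ≤ C ^ 2 * dirNormSq f}

/-- The column operator of `F` has norm at most `C`. -/
def ColNormLE (F : ℕ → ℂ → ℂ) (C : ℝ) : Prop :=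
  ∀ h, MemDirichlet h →
    Summable (fun j : ℕ => dirNormSq (fun z => F j z * h z)) ∧
    (∑' j : ℕ, dirNormSq (fun z => F j z * h z)) ≤ C ^ 2 * dirNormSq h

theorem hasSum_dirCoeff {f : ℂ → ℂ} (hf : DifferentiableOn ℂ f (ball 0 1)) {z : ℂ}
    (hz : z ∈ ball (0 : ℂ) 1) : HasSum (fun n => dirCoeff f n * z ^ n) (f z) := by
  have h : (fun n => dirCoeff f n * z ^ n)
      = fun n : ℕ => (n.factorial : ℂ)⁻¹ • (z - 0) ^ n • iteratedDeriv n f 0 := by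
    funext n
    simp only [dirCoeff, sub_zero, smul_eq_mul]
    ring
  rw [h]
  exact Complex.hasSum_taylorSeries_on_ball hf hz

theorem dirCoeff_deriv (f : ℂ → ℂ) (n : ℕ) :
    dirCoeff (deriv f) n = (n + 1) * dirCoeff f (n + 1) := by
  have h1 : (n.factorial : ℂ) ≠ 0 := by exact_mod_cast n.factorial_ne_zero
  have h2 : (n + 1 : ℂ) ≠ 0 := by exact_mod_cast n.succ_ne_zero
  rw [dirCoeff, dirCoeff, iteratedDeriv_succ', Nat.factorial_succ]
  push_cast
  field_simp

theorem dirCoeff_eq_of_hasSum {f : ℂ → ℂ} {c : ℕ → ℂ} (hf : DifferentiableOn ℂ f (ball 0 1))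
    (h : ∀ z ∈ ball (0 : ℂ) 1, HasSum (fun n => c n * z ^ n) (f z)) (n : ℕ) :
    dirCoeff f n = c n := by
  have hfa : AnalyticAt ℂ f 0 :=
    hf.analyticAt (isOpen_ball.mem_nhds (mem_ball_self one_pos))
  have hc : HasFPowerSeriesAt f (FormalMultilinearSeries.ofScalars ℂ c) 0 := by
    rw [hasFPowerSeriesAt_iff]
    filter_upwards [isOpen_ball.mem_nhds (mem_ball_self (x := (0 : ℂ)) one_pos)] with z hz
    simpa [mul_comm] using! h z hz
  have := congrArg (fun p => p.coeff n)
    (hfa.hasFPowerSeriesAt.eq_formalMultilinearSeries hc)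
  simpa [dirCoeff] using! this

theorem dirNormSq_nonneg (f : ℂ → ℂ) : 0 ≤ dirNormSq f :=
  tsum_nonneg fun _ => by positivity

theorem setIntegral_ball_norm_pow (n : ℕ) :
    ∫ z in ball (0 : ℂ) 1, ‖z‖ ^ (2 * n) = Real.pi / (n + 1) := by
  have h := integral_fun_norm_addHaar (volume : Measure ℂ)
    ((Set.Iio (1 : ℝ)).indicator fun t => t ^ (2 * n))
  have h1 : (fun z : ℂ => (Set.Iio (1 : ℝ)).indicator (fun t => t ^ (2 * n)) ‖z‖)
      = (ball (0 : ℂ) 1).indicator fun z => ‖z‖ ^ (2 * n) := by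
    ext z
    simp [Set.indicator]
  rw [h1, integral_indicator measurableSet_ball] at h
  have h2 : ∫ y in Set.Ioi (0 : ℝ),
      y ^ (2 - 1) • (Set.Iio (1 : ℝ)).indicator (fun t => t ^ (2 * n)) y = 1 / (2 * n + 2) := by
    have h3 : ∀ y : ℝ, y ^ (2 - 1) • (Set.Iio (1 : ℝ)).indicator (fun t => t ^ (2 * n)) y
        = (Set.Iio (1 : ℝ)).indicator (fun t => t ^ (2 * n + 1)) y := by
      intro y
      simp only [Set.indicator, smul_eq_mul]
      split_ifs
      · ring
      · simp
    simp_rw [h3]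
    rw [setIntegral_indicator measurableSet_Iio, Set.Ioi_inter_Iio, ← integral_Ioc_eq_integral_Ioo,
      ← intervalIntegral.integral_of_le zero_le_one, integral_pow]
    push_cast
    norm_num
    ring
  rw [h, Complex.finrank_real_complex, h2]
  simp only [Measure.real, Complex.volume_ball]
  norm_num
  field_simp

theorem setIntegral_ball_pow_mul_conj_pow (m n : ℕ) :
    ∫ z in ball (0 : ℂ) 1, z ^ m * (starRingEnd ℂ) (z ^ n)
      = if m = n then (Real.pi / (n + 1) : ℂ) else 0 := by
  split_ifs with hmn
  · subst hmn
    have h : ∀ z : ℂ, z ^ m * (starRingEnd ℂ) (z ^ m) = ((‖z‖ ^ (2 * m) : ℝ) : ℂ) := by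
      intro z
      rw [Complex.mul_conj, Complex.normSq_eq_norm_sq, norm_pow]
      push_cast
      ring
    simp_rw [h]
    rw [integral_complex_ofReal, setIntegral_ball_norm_pow]
    push_cast
    rfl
  · have hmn' : (m - n : ℂ) ≠ 0 := sub_ne_zero.mpr (by exact_mod_cast hmn)
    let u : Circle := Circle.exp (Real.pi / (m - n))
    have hu : (u : ℂ) ^ m * (starRingEnd ℂ) ((u : ℂ) ^ n) = -1 := by
      have hu' : (u : ℂ) = Complex.exp (Real.pi / (m - n) * Complex.I) := by
        simp [u, Circle.coe_exp]
      rw [map_pow, hu', ← Complex.exp_conj, ← Complex.exp_nat_mul, ← Complex.exp_nat_mul,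
        ← Complex.exp_add, ← Complex.exp_pi_mul_I]
      congr 1
      simp only [map_mul, map_div₀, map_sub, Complex.conj_ofReal, Complex.conj_I, map_natCast]
      field_simp
      ring
    have key := (rotation u).measurePreserving.setIntegral_preimage_emb
      (rotation u).toMeasurableEquiv.measurableEmbedding
      (fun z => z ^ m * (starRingEnd ℂ) (z ^ n)) (ball (0 : ℂ) 1)
    have hpre : (rotation u) ⁻¹' ball (0 : ℂ) 1 = ball (0 : ℂ) 1 := by
      ext z
      rw [Set.mem_preimage, mem_ball_zero_iff, mem_ball_zero_iff, LinearIsometryEquiv.norm_map]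
    have hrot : ∀ z : ℂ, (rotation u z) ^ m * (starRingEnd ℂ) ((rotation u z) ^ n)
        = -1 * (z ^ m * (starRingEnd ℂ) (z ^ n)) := by
      intro z
      rw [rotation_apply, mul_pow, mul_pow, map_mul, ← hu]
      ring
    simp_rw [hpre, hrot] at key
    rw [integral_const_mul] at key
    linear_combination (-1 / 2 : ℂ) * key

theorem integrableOn_ball_of_continuous {E : Type*} [NormedAddCommGroup E] {f : ℂ → E}
    (hf : Continuous f) : IntegrableOn f (ball (0 : ℂ) 1) :=
  (hf.continuousOn.integrableOn_compact (isCompact_closedBall 0 1)).mono_set ball_subset_closedBall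

theorem setIntegral_ball_norm_sum_sq (b : ℕ → ℂ) (N : ℕ) :
    ∫ z in ball (0 : ℂ) 1, ‖∑ n ∈ Finset.range N, b n * z ^ n‖ ^ 2
      = Real.pi * ∑ n ∈ Finset.range N, ‖b n‖ ^ 2 / (n + 1) := by
  have h : ∀ z : ℂ, ((‖∑ n ∈ Finset.range N, b n * z ^ n‖ ^ 2 : ℝ) : ℂ)
      = ∑ m ∈ Finset.range N, ∑ n ∈ Finset.range N,
        b m * (starRingEnd ℂ) (b n) * (z ^ m * (starRingEnd ℂ) (z ^ n)) := by
    intro z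
    rw [← Complex.normSq_eq_norm_sq, ← Complex.mul_conj, map_sum, Finset.sum_mul_sum]
    refine Finset.sum_congr rfl fun m _ => Finset.sum_congr rfl fun n _ => ?_
    rw [map_mul]
    ring
  have hcont : ∀ m n : ℕ, Continuous fun z : ℂ =>
      b m * (starRingEnd ℂ) (b n) * (z ^ m * (starRingEnd ℂ) (z ^ n)) := by
    intro m n
    fun_prop
  apply Complex.ofReal_injective
  rw [← integral_complex_ofReal]
  simp_rw [h]
  rw [integral_finsetSum _ fun m _ => integrable_finsetSum _ fun n _ =>
    integrableOn_ball_of_continuous (hcont m n)]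
  push_cast
  rw [Finset.mul_sum]
  refine Finset.sum_congr rfl fun m hm => ?_
  rw [integral_finsetSum _ fun n _ => integrableOn_ball_of_continuous (hcont m n)]
  simp_rw [integral_const_mul, setIntegral_ball_pow_mul_conj_pow]
  simp only [mul_ite, mul_zero, Finset.sum_ite_eq, hm, if_true]
  rw [Complex.mul_conj, Complex.normSq_eq_norm_sq]
  push_cast
  ring

theorem lintegral_ball_deriv_le {f : ℂ → ℂ} (hf : MemDirichlet f) :
    ∫⁻ z in ball (0 : ℂ) 1, ‖deriv f z‖ₑ ^ 2 ≤ ENNReal.ofReal (Real.pi * dirNormSq f) := by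
  let b : ℕ → ℂ := fun n => (n + 1) * dirCoeff f (n + 1)
  let p : ℕ → ℂ → ℂ := fun N z => ∑ n ∈ Finset.range N, b n * z ^ n
  have hp : ∀ N, Continuous (p N) := fun N => by fun_prop
  have hlim : ∀ z ∈ ball (0 : ℂ) 1,
      Filter.Tendsto (fun N => ‖p N z‖ₑ ^ 2) Filter.atTop (nhds (‖deriv f z‖ₑ ^ 2)) := by
    intro z hz
    have h := (hasSum_dirCoeff (hf.1.deriv isOpen_ball) hz).tendsto_sum_nat
    simp_rw [dirCoeff_deriv] at h
    exact ((ENNReal.continuous_pow 2).tendsto _).comp h.enorm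
  have hbound : ∀ N, ∫⁻ z in ball (0 : ℂ) 1, ‖p N z‖ₑ ^ 2
      ≤ ENNReal.ofReal (Real.pi * dirNormSq f) := by
    intro N
    have h1 : ∀ z, ‖p N z‖ₑ ^ 2 = ENNReal.ofReal (‖p N z‖ ^ 2) := fun z => by
      rw [ENNReal.ofReal_pow (norm_nonneg _), ofReal_norm]
    simp_rw [h1]
    rw [← ofReal_integral_eq_lintegral_ofReal
      (integrableOn_ball_of_continuous (f := fun z => ‖p N z‖ ^ 2) ((hp N).norm.pow 2))
      (Filter.Eventually.of_forall fun z => sq_nonneg _)]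
    refine ENNReal.ofReal_le_ofReal ?_
    simp only [p]
    rw [setIntegral_ball_norm_sum_sq]
    refine mul_le_mul_of_nonneg_left ?_ Real.pi_pos.le
    calc ∑ n ∈ Finset.range N, ‖b n‖ ^ 2 / (n + 1)
        ≤ ∑ n ∈ Finset.range N, (((n + 1 : ℕ) : ℝ) + 1) * ‖dirCoeff f (n + 1)‖ ^ 2 := by
          refine Finset.sum_le_sum fun n _ => ?_
          have hn : ‖(n + 1 : ℂ)‖ = n + 1 := by
            exact_mod_cast Complex.norm_natCast (n + 1)
          have hn' : (n + 1 : ℝ) ≠ 0 := by positivity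
          simp only [b, norm_mul, hn]
          push_cast
          have : ((n + 1) * ‖dirCoeff f (n + 1)‖) ^ 2 / (n + 1 : ℝ)
              = (n + 1) * ‖dirCoeff f (n + 1)‖ ^ 2 := by field_simp
          rw [this]
          gcongr
          linarith
      _ ≤ ∑ n ∈ Finset.range (N + 1), ((n : ℝ) + 1) * ‖dirCoeff f n‖ ^ 2 := by
          rw [Finset.sum_range_succ' _ N]
          exact le_add_of_nonneg_right (by positivity)
      _ ≤ dirNormSq f := hf.2.sum_le_tsum _ fun n _ => by positivity
  calc ∫⁻ z in ball (0 : ℂ) 1, ‖deriv f z‖ₑ ^ 2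
      = ∫⁻ z in ball (0 : ℂ) 1, Filter.liminf (fun N => ‖p N z‖ₑ ^ 2) Filter.atTop :=
        setLIntegral_congr_fun measurableSet_ball fun z hz => (hlim z hz).liminf_eq.symm
    _ ≤ Filter.liminf (fun N => ∫⁻ z in ball (0 : ℂ) 1, ‖p N z‖ₑ ^ 2) Filter.atTop :=
        lintegral_liminf_le fun N => ((hp N).measurable.enorm.pow_const 2)
    _ ≤ ENNReal.ofReal (Real.pi * dirNormSq f) := by
        refine Filter.liminf_le_of_frequently_le' (Filter.Frequently.of_forall hbound)

/-- The reproducing kernel of the Dirichlet space on the diagonal. -/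
noncomputable def dirKernelDiag (z : ℂ) : ℝ :=
  ∑' n : ℕ, (‖z‖ ^ n) ^ 2 / ((n : ℝ) + 1)

theorem summable_dirKernelDiag {z : ℂ} (hz : z ∈ ball (0 : ℂ) 1) :
    Summable fun n : ℕ => (‖z‖ ^ n) ^ 2 / ((n : ℝ) + 1) := by
  rw [mem_ball_zero_iff] at hz
  refine Summable.of_nonneg_of_le (fun n => by positivity) (fun n => ?_)
    (summable_geometric_of_lt_one (norm_nonneg z) hz)
  have h1 : ‖z‖ ^ n ≤ 1 := pow_le_one₀ (norm_nonneg z) hz.le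
  have h0 : 0 ≤ ‖z‖ ^ n := by positivity
  rw [div_le_iff₀ (by positivity)]
  nlinarith [mul_nonneg h0 (Nat.cast_nonneg (α := ℝ) n)]

theorem dirKernelDiag_pos {z : ℂ} (hz : z ∈ ball (0 : ℂ) 1) : 0 < dirKernelDiag z :=
  (summable_dirKernelDiag hz).tsum_pos (fun n => by positivity) 0 (by simp)

theorem norm_sq_le_dirKernelDiag {f : ℂ → ℂ} (hf : MemDirichlet f) {z : ℂ}
    (hz : z ∈ ball (0 : ℂ) 1) : ‖f z‖ ^ 2 ≤ dirKernelDiag z * dirNormSq f := by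
  refine le_of_tendsto (((hasSum_dirCoeff hf.1 hz).tendsto_sum_nat.norm).pow 2)
    (Filter.Eventually.of_forall fun N => ?_)
  calc ‖∑ n ∈ Finset.range N, dirCoeff f n * z ^ n‖ ^ 2
      ≤ (∑ n ∈ Finset.range N, ‖z‖ ^ n * ‖dirCoeff f n‖) ^ 2 := by
        gcongr
        refine (norm_sum_le _ _).trans_eq (Finset.sum_congr rfl fun n _ => ?_)
        rw [norm_mul, norm_pow, mul_comm]
    _ ≤ (∑ n ∈ Finset.range N, (‖z‖ ^ n) ^ 2 / ((n : ℝ) + 1)) *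
        ∑ n ∈ Finset.range N, ((n : ℝ) + 1) * ‖dirCoeff f n‖ ^ 2 := by
        refine Finset.sum_sq_le_sum_mul_sum_of_sq_le_mul _ (fun n _ => by positivity)
          (fun n _ => by positivity) fun n _ => le_of_eq ?_
        have hn : (n + 1 : ℝ) ≠ 0 := by positivity
        field_simp
    _ ≤ dirKernelDiag z * dirNormSq f := by
        refine mul_le_mul ((summable_dirKernelDiag hz).sum_le_tsum _ fun n _ => by positivity)
          (hf.2.sum_le_tsum _ fun n _ => by positivity)
          (Finset.sum_nonneg fun n _ => by positivity) (dirKernelDiag_pos hz).le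

/-- The Dirichlet space has a reproducing kernel at each point of the disk. -/
theorem exists_dirKernel {z : ℂ} (hz : z ∈ ball (0 : ℂ) 1) :
    ∃ k, MemDirichlet k ∧ dirNormSq k = dirKernelDiag z ∧ k z = dirKernelDiag z := by
  let c : ℕ → ℂ := fun n => (starRingEnd ℂ) z ^ n / (n + 1)
  have hnorm : ∀ n : ℕ, ‖(n + 1 : ℂ)‖ = n + 1 := fun n => by
    exact_mod_cast Complex.norm_natCast (n + 1)
  have hz' : ‖z‖ < 1 := by rwa [mem_ball_zero_iff] at hz
  have hc : ∀ n, ‖c n‖ ≤ ‖z‖ ^ n := fun n => by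
    simp only [c, norm_div, norm_pow, RCLike.norm_conj, hnorm]
    exact div_le_self (by positivity) (by linarith [Nat.cast_nonneg (α := ℝ) n])
  have hgeom := summable_geometric_of_lt_one (norm_nonneg z) hz'
  have hterm : ∀ n : ℕ, ∀ w ∈ ball (0 : ℂ) 1, ‖c n * w ^ n‖ ≤ ‖z‖ ^ n := fun n w hw => by
    rw [mem_ball_zero_iff] at hw
    rw [norm_mul, norm_pow]
    exact (mul_le_of_le_one_right (norm_nonneg _) (pow_le_one₀ (norm_nonneg w) hw.le)).trans (hc n)
  let k : ℂ → ℂ := fun w => ∑' n, c n * w ^ n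
  have hk : DifferentiableOn ℂ k (ball 0 1) :=
    Complex.differentiableOn_tsum_of_summable_norm hgeom (fun n => by fun_prop) isOpen_ball hterm
  have hksum : ∀ w ∈ ball (0 : ℂ) 1, HasSum (fun n => c n * w ^ n) (k w) := fun w hw =>
    (Summable.of_norm_bounded hgeom fun n => hterm n w hw).hasSum
  have hcoeff := dirCoeff_eq_of_hasSum hk hksum
  have hsq : ∀ n : ℕ, ((n : ℝ) + 1) * ‖dirCoeff k n‖ ^ 2 = (‖z‖ ^ n) ^ 2 / ((n : ℝ) + 1) := by
    intro n
    rw [hcoeff]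
    simp only [c, norm_div, norm_pow, RCLike.norm_conj, hnorm]
    have hn : (n + 1 : ℝ) ≠ 0 := by positivity
    field_simp
  refine ⟨k, ⟨hk, ?_⟩, ?_, ?_⟩
  · simp_rw [hsq]
    exact summable_dirKernelDiag hz
  · simp_rw [dirNormSq, hsq]
    rfl
  · simp only [k, dirKernelDiag, c]
    rw [Complex.ofReal_tsum]
    refine tsum_congr fun n => ?_
    push_cast
    rw [div_mul_eq_mul_div, ← mul_pow, mul_comm _ z, Complex.mul_conj, Complex.normSq_eq_norm_sq]
    push_cast
    ring

theorem tsum_enorm_sq_le_one {F : ℕ → ℂ → ℂ} (hF : ∀ j, IsMultiplier (F j))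
    (hcol : ColNormLE F 1) {z : ℂ} (hz : z ∈ ball (0 : ℂ) 1) : ∑' j, ‖F j z‖ₑ ^ 2 ≤ 1 := by
  obtain ⟨k, hk, hknorm, hkz⟩ := exists_dirKernel hz
  have hK := dirKernelDiag_pos hz
  obtain ⟨hsum, hle⟩ := hcol k hk
  rw [hknorm, one_pow, one_mul] at hle
  have hpt : ∀ j, ‖F j z‖ ^ 2 ≤ dirNormSq (fun w => F j w * k w) / dirKernelDiag z := by
    intro j
    have h := norm_sq_le_dirKernelDiag ((hF j).2 k hk) hz
    rw [hkz, norm_mul, Complex.norm_real, Real.norm_of_nonneg hK.le] at h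
    rw [le_div_iff₀ hK]
    refine le_of_mul_le_mul_left ?_ hK
    calc _ = _ := by ring
      _ ≤ _ := h
  calc ∑' j, ‖F j z‖ₑ ^ 2
      ≤ ∑' j, ENNReal.ofReal (dirNormSq (fun w => F j w * k w) / dirKernelDiag z) := by
        refine ENNReal.tsum_le_tsum fun j => ?_
        rw [← ofReal_norm, ← ENNReal.ofReal_pow (norm_nonneg _)]
        exact ENNReal.ofReal_le_ofReal (hpt j)
    _ = ENNReal.ofReal ((∑' j, dirNormSq (fun w => F j w * k w)) / dirKernelDiag z) := by
        rw [← tsum_div_const, ENNReal.ofReal_tsum_of_nonneg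
          (fun j => div_nonneg (dirNormSq_nonneg _) hK.le) (hsum.div_const _)]
    _ ≤ 1 := by
        rw [ENNReal.ofReal_le_one]
        exact div_le_one_of_le₀ hle hK.le

theorem enorm_add_sq_le (a b : ℂ) : ‖a + b‖ₑ ^ 2 ≤ 2 * ‖a‖ₑ ^ 2 + 2 * ‖b‖ₑ ^ 2 := by
  have h : ‖a + b‖ ^ 2 ≤ 2 * ‖a‖ ^ 2 + 2 * ‖b‖ ^ 2 := by
    have := pow_le_pow_left₀ (norm_nonneg _) (norm_add_le a b) 2
    nlinarith [sq_nonneg (‖a‖ - ‖b‖)]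
  simp_rw [← ofReal_norm, ← ENNReal.ofReal_pow (norm_nonneg _)]
  refine (ENNReal.ofReal_le_ofReal h).trans_eq ?_
  rw [ENNReal.ofReal_add (by positivity) (by positivity), ENNReal.ofReal_mul zero_le_two,
    ENNReal.ofReal_mul zero_le_two, ENNReal.ofReal_ofNat]

theorem aemeasurable_enorm_sq_ball {f : ℂ → ℂ} (hf : DifferentiableOn ℂ f (ball 0 1)) :
    AEMeasurable (fun z => ‖f z‖ₑ ^ 2) (volume.restrict (ball 0 1)) :=
  (hf.continuousOn.aemeasurable measurableSet_ball).enorm.pow_const 2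

theorem lintegral_ball_tsum_deriv_mul_le {F : ℕ → ℂ → ℂ} (hF : ∀ j, IsMultiplier (F j))
    (hcol : ColNormLE F 1) {h : ℂ → ℂ} (hh : MemDirichlet h) :
    ∫⁻ z in ball (0 : ℂ) 1, (∑' k, ‖deriv (F k) z‖ₑ ^ 2) * ‖h z‖ₑ ^ 2
      ≤ ENNReal.ofReal (4 * Real.pi * dirNormSq h) := by
  obtain ⟨hsum, hle⟩ := hcol h hh
  rw [one_pow, one_mul] at hle
  have hpt : ∀ z ∈ ball (0 : ℂ) 1, (∑' k, ‖deriv (F k) z‖ₑ ^ 2) * ‖h z‖ₑ ^ 2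
      ≤ 2 * (∑' k, ‖deriv (fun w => F k w * h w) z‖ₑ ^ 2) + 2 * ‖deriv h z‖ₑ ^ 2 := by
    intro z hz
    have hnhds := isOpen_ball.mem_nhds hz
    calc (∑' k, ‖deriv (F k) z‖ₑ ^ 2) * ‖h z‖ₑ ^ 2
        = ∑' k, ‖deriv (F k) z * h z‖ₑ ^ 2 := by
          simp_rw [enorm_mul, mul_pow, ENNReal.tsum_mul_right]
      _ ≤ ∑' k, (2 * ‖deriv (fun w => F k w * h w) z‖ₑ ^ 2
            + 2 * (‖F k z‖ₑ ^ 2 * ‖deriv h z‖ₑ ^ 2)) := by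
          refine ENNReal.tsum_le_tsum fun k => ?_
          have hd : deriv (F k) z * h z
              = deriv (fun w => F k w * h w) z + -(F k z * deriv h z) := by
            rw [deriv_fun_mul ((hF k).1.differentiableAt hnhds) (hh.1.differentiableAt hnhds)]
            ring
          rw [hd]
          refine (enorm_add_sq_le _ _).trans_eq ?_
          rw [enorm_neg, enorm_mul, mul_pow]
      _ = 2 * (∑' k, ‖deriv (fun w => F k w * h w) z‖ₑ ^ 2)
            + 2 * ((∑' k, ‖F k z‖ₑ ^ 2) * ‖deriv h z‖ₑ ^ 2) := by
          rw [ENNReal.tsum_add, ENNReal.tsum_mul_left, ENNReal.tsum_mul_left,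
            ENNReal.tsum_mul_right]
      _ ≤ _ := by
          gcongr
          exact mul_le_of_le_one_left' (tsum_enorm_sq_le_one hF hcol hz)
  have hmeas : ∀ k, AEMeasurable (fun z => ‖deriv (fun w => F k w * h w) z‖ₑ ^ 2)
      (volume.restrict (ball 0 1)) := fun k =>
    aemeasurable_enorm_sq_ball (((hF k).2 h hh).1.deriv isOpen_ball)
  calc ∫⁻ z in ball (0 : ℂ) 1, (∑' k, ‖deriv (F k) z‖ₑ ^ 2) * ‖h z‖ₑ ^ 2
      ≤ ∫⁻ z in ball (0 : ℂ) 1, (2 * (∑' k, ‖deriv (fun w => F k w * h w) z‖ₑ ^ 2)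
          + 2 * ‖deriv h z‖ₑ ^ 2) := setLIntegral_mono' measurableSet_ball hpt
    _ = 2 * (∑' k, ∫⁻ z in ball (0 : ℂ) 1, ‖deriv (fun w => F k w * h w) z‖ₑ ^ 2)
          + 2 * ∫⁻ z in ball (0 : ℂ) 1, ‖deriv h z‖ₑ ^ 2 := by
        rw [lintegral_add_right' _
            ((aemeasurable_enorm_sq_ball (hh.1.deriv isOpen_ball)).const_mul 2),
          lintegral_const_mul' _ _ ENNReal.ofNat_ne_top,
          lintegral_const_mul' _ _ ENNReal.ofNat_ne_top, lintegral_tsum hmeas]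
    _ ≤ 2 * (∑' k, ENNReal.ofReal (Real.pi * dirNormSq (fun w => F k w * h w)))
          + 2 * ENNReal.ofReal (Real.pi * dirNormSq h) := by
        gcongr with k
        · exact lintegral_ball_deriv_le ((hF k).2 h hh)
        · exact lintegral_ball_deriv_le hh
    _ = 2 * ENNReal.ofReal (Real.pi * ∑' k, dirNormSq (fun w => F k w * h w))
          + 2 * ENNReal.ofReal (Real.pi * dirNormSq h) := by
        rw [← tsum_mul_left, ENNReal.ofReal_tsum_of_nonneg
          (fun k => mul_nonneg Real.pi_pos.le (dirNormSq_nonneg _)) (hsum.mul_left _)]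
    _ ≤ 2 * ENNReal.ofReal (Real.pi * dirNormSq h)
          + 2 * ENNReal.ofReal (Real.pi * dirNormSq h) := by
        gcongr
    _ = ENNReal.ofReal (4 * Real.pi * dirNormSq h) := by
        rw [← add_mul, mul_assoc, ENNReal.ofReal_mul (p := 4) (by norm_num), ENNReal.ofReal_ofNat]
        norm_num

theorem ofReal_tsum_norm_sq_le (a : ℕ → ℂ) :
    ENNReal.ofReal (∑' k, ‖a k‖ ^ 2) ≤ ∑' k, ‖a k‖ₑ ^ 2 := by
  by_cases h : Summable fun k => ‖a k‖ ^ 2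
  · rw [ENNReal.ofReal_tsum_of_nonneg (fun k => by positivity) h]
    simp_rw [ENNReal.ofReal_pow (norm_nonneg _), ofReal_norm]
    exact le_rfl
  · simp [tsum_eq_zero_of_not_summable h]

/-- Lemma 2: if the entries of `Q` are `0` or `± f k` and the entrywise
derivative `Q'` is dominated by `(∑ |fⱼ'|²)^{1/2}`, then for an
`ℓ²`-valued harmonic function `w = x + ȳ` on a neighborhood of the closed
disk, `∫_𝔻 ‖Q' w‖² dA ≤ 8 ‖w‖²_{ℋ𝒟}` (with `dA` normalized by `π`). -/
theorem Qprime_harmonic_estimate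
    (F : ℕ → ℂ → ℂ) (hF : ∀ j, IsMultiplier (F j)) (hcol : ColNormLE F 1)
    (q : ℕ → ℕ → ℂ → ℂ)
    (hentries : ∀ i j : ℕ, (∀ z : ℂ, q i j z = 0) ∨
      ∃ k : ℕ, (∀ z : ℂ, q i j z = F k z) ∨ (∀ z : ℂ, q i j z = -(F k z)))
    (hq' : ∀ z ∈ ball (0:ℂ) 1, ∀ v : ℕ → ℂ, Summable (fun j : ℕ => ‖v j‖ ^ 2) →
      (∑' i : ℕ, ‖∑' j : ℕ, deriv (q i j) z * v j‖ ^ 2)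
        ≤ (∑' k : ℕ, ‖deriv (F k) z‖ ^ 2) * ∑' j : ℕ, ‖v j‖ ^ 2)
    (x y : ℕ → ℂ → ℂ) (r : ℝ) (hr : 1 < r)
    (hx : ∀ j, DifferentiableOn ℂ (x j) (ball (0:ℂ) r))
    (hy : ∀ j, DifferentiableOn ℂ (y j) (ball (0:ℂ) r))
    (hxD : ∀ j, MemDirichlet (x j)) (hyD : ∀ j, MemDirichlet (y j))
    (hxS : Summable fun j : ℕ => dirNormSq (x j))
    (hyS : Summable fun j : ℕ => dirNormSq (y j)) :
    (1 / Real.pi) * (∫ z in ball (0:ℂ) 1,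
        ∑' i : ℕ, ‖∑' j : ℕ, deriv (q i j) z * (x j z + (starRingEnd ℂ) (y j z))‖ ^ 2)
      ≤ 8 * ((∑' j : ℕ, dirNormSq (x j)) + ∑' j : ℕ, dirNormSq (y j)) := by
  let v : ℕ → ℂ → ℂ := fun j z => x j z + (starRingEnd ℂ) (y j z)
  let D : ℂ → ENNReal := fun z => ∑' k, ‖deriv (F k) z‖ₑ ^ 2
  let G : ℂ → ℝ := fun z => ∑' i : ℕ, ‖∑' j : ℕ, deriv (q i j) z * v j z‖ ^ 2
  have hG : ∀ z, 0 ≤ G z := fun z => tsum_nonneg fun i => by positivity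
  have hvsum : ∀ z ∈ ball (0 : ℂ) 1, Summable fun j => ‖v j z‖ ^ 2 := by
    intro z hz
    refine Summable.of_nonneg_of_le (fun j => by positivity) (fun j => ?_)
      (((hxS.add hyS).mul_left (dirKernelDiag z)).mul_left 2)
    have h1 := norm_sq_le_dirKernelDiag (hxD j) hz
    have h2 := norm_sq_le_dirKernelDiag (hyD j) hz
    have h3 : ‖v j z‖ ≤ ‖x j z‖ + ‖y j z‖ :=
      (norm_add_le _ _).trans_eq (by rw [RCLike.norm_conj])
    have h4 := pow_le_pow_left₀ (norm_nonneg _) h3 2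
    nlinarith [sq_nonneg (‖x j z‖ - ‖y j z‖)]
  have hpt : ∀ z ∈ ball (0 : ℂ) 1, ENNReal.ofReal (G z)
      ≤ ∑' j, (2 * (D z * ‖x j z‖ₑ ^ 2) + 2 * (D z * ‖y j z‖ₑ ^ 2)) := by
    intro z hz
    calc ENNReal.ofReal (G z)
        ≤ ENNReal.ofReal ((∑' k, ‖deriv (F k) z‖ ^ 2) * ∑' j, ‖v j z‖ ^ 2) :=
          ENNReal.ofReal_le_ofReal (hq' z hz (fun j => v j z) (hvsum z hz))
      _ ≤ D z * ∑' j, ‖v j z‖ₑ ^ 2 := by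
          rw [ENNReal.ofReal_mul (tsum_nonneg fun k => by positivity)]
          exact mul_le_mul' (ofReal_tsum_norm_sq_le _) (ofReal_tsum_norm_sq_le _)
      _ = ∑' j, D z * ‖v j z‖ₑ ^ 2 := ENNReal.tsum_mul_left.symm
      _ ≤ _ := by
          refine ENNReal.tsum_le_tsum fun j => ?_
          calc D z * ‖v j z‖ₑ ^ 2
              ≤ D z * (2 * ‖x j z‖ₑ ^ 2 + 2 * ‖(starRingEnd ℂ) (y j z)‖ₑ ^ 2) := by
                gcongr
                exact enorm_add_sq_le _ _
            _ = _ := by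
                rw [RCLike.enorm_conj]
                ring
  have hD : AEMeasurable D (volume.restrict (ball 0 1)) :=
    AEMeasurable.tsum fun k =>
      aemeasurable_enorm_sq_ball ((hF k).1.deriv isOpen_ball)
  have hmeas : ∀ f, MemDirichlet f → AEMeasurable (fun z => 2 * (D z * ‖f z‖ₑ ^ 2))
      (volume.restrict (ball 0 1)) := fun f hf =>
    (hD.mul (aemeasurable_enorm_sq_ball hf.1)).const_mul 2
  have hint : ∀ f, MemDirichlet f → ∫⁻ z in ball (0 : ℂ) 1, 2 * (D z * ‖f z‖ₑ ^ 2)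
      ≤ ENNReal.ofReal (8 * Real.pi * dirNormSq f) := fun f hf => by
    rw [lintegral_const_mul' _ _ ENNReal.ofNat_ne_top]
    calc 2 * ∫⁻ z in ball (0 : ℂ) 1, D z * ‖f z‖ₑ ^ 2
        ≤ 2 * ENNReal.ofReal (4 * Real.pi * dirNormSq f) := by
          gcongr
          exact lintegral_ball_tsum_deriv_mul_le hF hcol hf
      _ = ENNReal.ofReal (8 * Real.pi * dirNormSq f) := by
          rw [← ENNReal.ofReal_ofNat 2, ← ENNReal.ofReal_mul zero_le_two]
          ring_nf
  have h8 : ∀ f, 0 ≤ 8 * Real.pi * dirNormSq f := fun f =>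
    mul_nonneg (by positivity) (dirNormSq_nonneg f)
  have hlint : ∫⁻ z in ball (0 : ℂ) 1, ENNReal.ofReal (G z)
      ≤ ENNReal.ofReal (8 * Real.pi * ((∑' j, dirNormSq (x j)) + ∑' j, dirNormSq (y j))) := by
    calc ∫⁻ z in ball (0 : ℂ) 1, ENNReal.ofReal (G z)
        ≤ ∫⁻ z in ball (0 : ℂ) 1,
            ∑' j, (2 * (D z * ‖x j z‖ₑ ^ 2) + 2 * (D z * ‖y j z‖ₑ ^ 2)) :=
          setLIntegral_mono' measurableSet_ball hpt
      _ = ∑' j, ((∫⁻ z in ball (0 : ℂ) 1, 2 * (D z * ‖x j z‖ₑ ^ 2))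
            + ∫⁻ z in ball (0 : ℂ) 1, 2 * (D z * ‖y j z‖ₑ ^ 2)) := by
          refine (lintegral_tsum fun j => (hmeas _ (hxD j)).add (hmeas _ (hyD j))).trans ?_
          exact tsum_congr fun j => lintegral_add_right' _ (hmeas _ (hyD j))
      _ ≤ ∑' j, (ENNReal.ofReal (8 * Real.pi * dirNormSq (x j))
            + ENNReal.ofReal (8 * Real.pi * dirNormSq (y j))) :=
          ENNReal.tsum_le_tsum fun j => add_le_add (hint _ (hxD j)) (hint _ (hyD j))
      _ = _ := by
          rw [ENNReal.tsum_add, ← ENNReal.ofReal_tsum_of_nonneg (fun j => h8 _) (hxS.mul_left _),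
            ← ENNReal.ofReal_tsum_of_nonneg (fun j => h8 _) (hyS.mul_left _),
            ← ENNReal.ofReal_add (tsum_nonneg fun j => h8 _) (tsum_nonneg fun j => h8 _),
            tsum_mul_left, tsum_mul_left, mul_add]
  have hN : 0 ≤ (∑' j, dirNormSq (x j)) + ∑' j, dirNormSq (y j) :=
    add_nonneg (tsum_nonneg fun j => dirNormSq_nonneg _) (tsum_nonneg fun j => dirNormSq_nonneg _)
  have hmain : ∫ z in ball (0 : ℂ) 1, G z
      ≤ 8 * Real.pi * ((∑' j, dirNormSq (x j)) + ∑' j, dirNormSq (y j)) := by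
    by_cases hGi : IntegrableOn G (ball 0 1)
    · rw [integral_eq_lintegral_of_nonneg_ae (Filter.Eventually.of_forall hG)
        hGi.aestronglyMeasurable]
      exact ENNReal.toReal_le_of_le_ofReal (by positivity) hlint
    · rw [integral_undef hGi]
      positivity
  rw [one_div, inv_mul_le_iff₀ Real.pi_pos]
  exact hmain.trans_eq (by ring)
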